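/- If F is a free filter on ω without the Nikodym property, then F* ≤_K Z, where F* is the dual ideal of F and Z is the asymptotic density zero ideal. -/

import Mathlib

open Filter Topology Set MeasureTheory
open scoped ENNReal NNReal

noncomputable section

/-- The space `N_F = ℕ ∪ {p_F}`, modelled as `Option ℕ` with `none` playing the role of `p_F`:
every natural number (i.e. `some n`) is isolated, and a set containing `none` is open iff its
trace on `ℕ` belongs to `F`. -/
def NFTop (F : Filter ℕ) : TopologicalSpace (Option ℕ) where
  IsOpen U := none ∈ U → {n : ℕ | some n ∈ U} ∈ F
  isOpen_univ := fun _ => Filter.univ_mem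
  isOpen_inter := fun U V hU hV h => Filter.inter_mem (hU h.1) (hV h.2)
  isOpen_sUnion := fun S hS h => by
    obtain ⟨U, hUS, hU⟩ := h
    exact Filter.mem_of_superset (hS U hUS hU) fun n hn => ⟨U, hUS, hn⟩

/-- A finitely supported signed measure on `N_F` is modelled as a finitely supported
function `Option ℕ →₀ ℝ`; its value on a set `A` is the sum of its weights on `A`. -/
def fsMeas (μ : Option ℕ →₀ ℝ) (A : Set (Option ℕ)) : ℝ :=
  ∑ x ∈ μ.support, A.indicator (fun y => μ y) x

/-- The norm `‖μ‖ = Σ |α_i|` of a finitely supported signed measure. -/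
def fsNorm (μ : Option ℕ →₀ ℝ) : ℝ :=
  ∑ x ∈ μ.support, |μ x|

/-- `‖μ ↾ B‖`, the variation of `μ` on a set `B`. -/
def fsRestrNorm (μ : Option ℕ →₀ ℝ) (B : Set (Option ℕ)) : ℝ :=
  ∑ x ∈ μ.support, B.indicator (fun y => |μ y|) x

/-- The integral `∫ f dμ` of a function against a finitely supported signed measure. -/
def fsInteg (μ : Option ℕ →₀ ℝ) (f : Option ℕ → ℝ) : ℝ :=
  ∑ x ∈ μ.support, μ x * f x

/-- An anti-Nikodym sequence on `N_F`: `‖μ_n‖ → ∞` and `μ_n(A) → 0` for every clopen `A`. -/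
def IsANSeq (F : Filter ℕ) (μ : ℕ → (Option ℕ →₀ ℝ)) : Prop :=
  Tendsto (fun n => fsNorm (μ n)) atTop atTop ∧
    ∀ A : Set (Option ℕ), @IsClopen _ (NFTop F) A →
      Tendsto (fun n => fsMeas (μ n) A) atTop (nhds 0)

/-- A free filter `F` has the Nikodym property if there is no anti-Nikodym sequence on `N_F`. -/
def HasNikodymProp (F : Filter ℕ) : Prop :=
  ¬ ∃ μ : ℕ → (Option ℕ →₀ ℝ), IsANSeq F μ

/-- A finitely supported (nonnegative) measure on `ℕ`, evaluated on a set `A ⊆ ℕ`. -/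
def natMeas (μ : ℕ →₀ ℝ) (A : Set ℕ) : ℝ :=
  ∑ x ∈ μ.support, A.indicator (fun y => μ y) x

/-- The norm of a finitely supported measure on `ℕ`. -/
def natNorm (μ : ℕ →₀ ℝ) : ℝ :=
  ∑ x ∈ μ.support, |μ x|

/-- `at⁺(μ)`: the largest atom of a finitely supported measure on `ℕ`. -/
def atPlus (μ : ℕ →₀ ℝ) : ℝ := sSup ((fun x => μ x) '' ↑μ.support)

/-- `at⁻(μ)`: the smallest atom of a finitely supported measure on `ℕ`. -/
def atMinus (μ : ℕ →₀ ℝ) : ℝ := sInf ((fun x => μ x) '' ↑μ.support)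

/-- A submeasure on `ω`. -/
structure Submeasure where
  toFun : Set ℕ → ℝ≥0∞
  empty' : toFun ∅ = 0
  finite_singleton' : ∀ n : ℕ, toFun {n} ≠ ⊤
  mono' : ∀ ⦃A B : Set ℕ⦄, A ⊆ B → toFun A ≤ toFun B
  subadd' : ∀ A B : Set ℕ, toFun (A ∪ B) ≤ toFun A + toFun B

/-- Lower semicontinuity of a submeasure: `φ(A) = lim_n φ(A ∩ [0,n])`. -/
def Submeasure.LSC (φ : Submeasure) : Prop :=
  ∀ A : Set ℕ, Tendsto (fun n : ℕ => φ.toFun (A ∩ Set.Iic n)) atTop (nhds (φ.toFun A))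

/-- The exhaustive ideal `Exh(φ) = {A : lim_n φ(A ∖ [0,n]) = 0}` of a submeasure. -/
def Exh (φ : Submeasure) : Set (Set ℕ) :=
  {A : Set ℕ | Tendsto (fun n : ℕ => φ.toFun (A \ Set.Iic n)) atTop (nhds 0)}

/-- A density submeasure: `φ = sup_n μ_n` for a sequence of finitely supported nonnegative
measures on `ℕ` with pairwise disjoint supports. -/
def Submeasure.IsDensity (φ : Submeasure) : Prop :=
  ∃ μ : ℕ → (ℕ →₀ ℝ), (∀ n x, 0 ≤ μ n x) ∧
    (∀ m n, m ≠ n → Disjoint (μ m).support (μ n).support) ∧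
    ∀ A : Set ℕ, φ.toFun A = ⨆ n : ℕ, ENNReal.ofReal (natMeas (μ n) A)

/-- A non-pathological submeasure: `φ(A)` is the supremum of `μ(A)` over all nonnegative
(σ-additive) measures `μ` on `ℕ` dominated by `φ`. -/
def Submeasure.Nonpathological (φ : Submeasure) : Prop :=
  ∀ A : Set ℕ,
    φ.toFun A =
      ⨆ (w : ℕ → ℝ≥0∞) (_ : ∀ B : Set ℕ, ∑' n : B, w n ≤ φ.toFun B), ∑' n : A, w n

/-- An ideal on `ω`: contains all finite sets, closed under subsets and finite unions,
and does not contain `ℕ` itself. -/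
def IsIdeal (I : Set (Set ℕ)) : Prop :=
  (∀ A : Set ℕ, A.Finite → A ∈ I) ∧
    (∀ A B : Set ℕ, A ⊆ B → B ∈ I → A ∈ I) ∧
    (∀ A B : Set ℕ, A ∈ I → B ∈ I → A ∪ B ∈ I) ∧
    Set.univ ∉ I

/-- The Katětov order on families of subsets of `ℕ`. -/
def KatLE (I J : Set (Set ℕ)) : Prop :=
  ∃ f : ℕ → ℕ, ∀ A ∈ I, f ⁻¹' A ∈ J

/-- The dual filter `I*` of an ideal `I` (as a `Filter`; when `I` is an ideal, this filter's
sets are exactly the complements of members of `I`). -/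
def dualFilter (I : Set (Set ℕ)) : Filter ℕ :=
  Filter.generate {A : Set ℕ | Aᶜ ∈ I}

/-- The class `AN` of all ideals on `ω` whose dual filters do not have the Nikodym property. -/
def ANclass : Set (Set (Set ℕ)) :=
  {I | IsIdeal I ∧ ¬ HasNikodymProp (dualFilter I)}

/-- A density ideal: `Exh(sup_n μ_n)` for a disjointly supported sequence of finitely
supported nonnegative measures on `ℕ`. -/
def IsDensityIdeal (I : Set (Set ℕ)) : Prop :=
  ∃ μ : ℕ → (ℕ →₀ ℝ), (∀ n x, 0 ≤ μ n x) ∧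
    (∀ m n, m ≠ n → Disjoint (μ m).support (μ n).support) ∧
    I = {A : Set ℕ |
      Tendsto (fun m : ℕ => ⨆ n : ℕ, ENNReal.ofReal (natMeas (μ n) (A \ Set.Iic m)))
        atTop (nhds 0)}

/-- The asymptotic density submeasure `φ_d(A) = sup_n |A ∩ [2^n, 2^{n+1})|/2^n`. -/
def phid (A : Set ℕ) : ℝ≥0∞ :=
  ⨆ n : ℕ, ((A ∩ Set.Ico (2 ^ n) (2 ^ (n + 1))).ncard : ℝ≥0∞) / 2 ^ n

/-- The asymptotic density zero ideal `Z = Exh(φ_d)`. -/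
def Zideal : Set (Set ℕ) :=
  {A : Set ℕ | Tendsto (fun m : ℕ => phid (A \ Set.Iic m)) atTop (nhds 0)}

/-- `Exh(sup_{n ≥ 1} ν_n)` for a sequence of finitely supported measures indexed by `n ≥ 1`. -/
def ExhSupPos (ν : ℕ → (ℕ →₀ ℝ)) : Set (Set ℕ) :=
  {A : Set ℕ |
    Tendsto (fun m : ℕ => ⨆ n : ℕ, ENNReal.ofReal (natMeas (ν (n + 1)) (A \ Set.Iic m)))
      atTop (nhds 0)}

/-- `PhiStart f n` is the left endpoint of the interval `I_n` in the interval partition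
associated with `f` (so `I_n = [PhiStart f n, PhiStart f (n+1))` has `n·f(n)` elements). -/
def PhiStart (f : ℕ → ℕ) (n : ℕ) : ℕ :=
  ∑ k ∈ Finset.range n, k * f k

/-- The density ideal `Φ(f) = Exh(sup_{n≥1} μ_n^f)`, where `μ_n^f` gives mass `1/f(n)` to each
point of the interval `I_n` (of size `n·f(n)`), so that `‖μ_n^f‖ = n`. -/
def PhiIdeal (f : ℕ → ℕ) : Set (Set ℕ) :=
  {A : Set ℕ |
    Tendsto (fun m : ℕ => ⨆ n : ℕ,
        ENNReal.ofReal
          (((A \ Set.Iic m) ∩ Set.Ico (PhiStart f (n + 1)) (PhiStart f (n + 2))).ncard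
            / f (n + 1)))
      atTop (nhds 0)}

/-- The dominating number `𝔡`. -/
def domNumber : Cardinal :=
  sInf {c : Cardinal | ∃ D : Set (ℕ → ℕ), Cardinal.mk D = c ∧
    ∀ g : ℕ → ℕ, ∃ f ∈ D, ∀ᶠ n in atTop, g n ≤ f n}

/-- The unbounding number `𝔟`. -/
def unbNumber : Cardinal :=
  sInf {c : Cardinal | ∃ U : Set (ℕ → ℕ), Cardinal.mk U = c ∧
    ∀ g : ℕ → ℕ, ∃ f ∈ U, {n : ℕ | g n < f n}.Infinite}

/-- A P-ideal: every countable family in `J` has a pseudo-union in `J`. -/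
def IsPIdeal (J : Set (Set ℕ)) : Prop :=
  ∀ A : ℕ → Set ℕ, (∀ n, A n ∈ J) → ∃ B ∈ J, ∀ n, (A n \ B).Finite

/-- The characteristic-function embedding of `P(ℕ)` into the Cantor space `2^ℕ`. -/
def chi (A : Set ℕ) : ℕ → Bool :=
  fun n => @decide (n ∈ A) (Classical.propDecidable _)

end

lemma natMeas_eq_sum_of_subset {ν : ℕ →₀ ℝ} {T : Finset ℕ} (hT : ν.support ⊆ T) (B : Set ℕ) :
    natMeas ν B = ∑ i ∈ T, B.indicator ν i := by
  refine Finset.sum_subset hT fun i _ hi => ?_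
  by_cases hB : i ∈ B <;> simp_all

lemma natMeas_singleton (ν : ℕ →₀ ℝ) (i : ℕ) : natMeas ν {i} = ν i := by
  classical
  rw [natMeas_eq_sum_of_subset (Finset.subset_insert i ν.support),
    Finset.sum_eq_single_of_mem i (Finset.mem_insert_self _ _)] <;> simp +contextual

/-- The variation of `ν` on a set `A`. -/
noncomputable def natVar (ν : ℕ →₀ ℝ) (A : Set ℕ) : ℝ :=
  ∑ i ∈ ν.support, A.indicator (fun j => |ν j|) i

lemma natVar_nonneg (ν : ℕ →₀ ℝ) (A : Set ℕ) : 0 ≤ natVar ν A :=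
  Finset.sum_nonneg fun _ _ => indicator_nonneg (fun _ _ => abs_nonneg _) _

lemma natVar_eq_natMeas_sub (ν : ℕ →₀ ℝ) (A : Set ℕ) :
    natVar ν A = natMeas ν {i ∈ A | 0 < ν i} - natMeas ν {i ∈ A | ν i ≤ 0} := by
  simp only [natVar, natMeas, ← Finset.sum_sub_distrib]
  refine Finset.sum_congr rfl fun i _ => ?_
  by_cases hA : i ∈ A
  · rcases lt_or_ge 0 (ν i) with h | h
    · simp [indicator, hA, h, h.not_ge, abs_of_pos h]
    · simp [indicator, hA, h, h.not_gt, abs_of_nonpos h]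
  · simp [indicator, hA]

/-- Two subsets of `A` which agree off a finite set `I` have values close to each other. -/
lemma abs_natMeas_sub_le (ν : ℕ →₀ ℝ) {A B C : Set ℕ} (hB : B ⊆ A) (hC : C ⊆ A)
    (I : Finset ℕ) (h : ∀ i ∉ I, (i ∈ B ↔ i ∈ C)) :
    |natMeas ν B - natMeas ν C| ≤ ∑ i ∈ I, A.indicator (fun j => |ν j|) i := by
  classical
  rw [natMeas_eq_sum_of_subset (T := ν.support ∪ I) Finset.subset_union_left,
    natMeas_eq_sum_of_subset (T := ν.support ∪ I) Finset.subset_union_left,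
    ← Finset.sum_sub_distrib,
    ← Finset.sum_subset (s₁ := I) Finset.subset_union_right]
  · refine (Finset.abs_sum_le_sum_abs _ _).trans (Finset.sum_le_sum fun i _ => ?_)
    by_cases hA : i ∈ A
    · by_cases h1 : i ∈ B <;> by_cases h2 : i ∈ C <;> simp [h1, h2, hA]
    · have h1 : i ∉ B := fun h => hA (hB h)
      have h2 : i ∉ C := fun h => hA (hC h)
      simp [h1, h2, hA]
  · intro i _ hi
    simp [indicator, h i hi]

lemma continuous_natMeas (ν : ℕ →₀ ℝ) (A : Set ℕ) :
    Continuous fun x : ℕ → Bool => natMeas ν {i ∈ A | x i = true} := by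
  refine continuous_finsetSum _ fun i _ => ?_
  exact (continuous_of_discreteTopology
    (f := fun b : Bool => {j ∈ A | b = true}.indicator ν i)).comp (continuous_apply i)

/-- A form of the Schur property: if a sequence of finitely supported measures converges to `0` on
every subset of `A`, then the variations on `A` converge to `0`. -/
lemma tendsto_natVar_zero {ν : ℕ → ℕ →₀ ℝ} {A : Set ℕ}
    (h : ∀ B ⊆ A, Tendsto (fun n => natMeas (ν n) B) atTop (𝓝 0)) :
    Tendsto (fun n => natVar (ν n) A) atTop (𝓝 0) := by
  have habs : ∀ B ⊆ A, ∀ ε > 0, ∀ᶠ n in atTop, |natMeas (ν n) B| ≤ ε := fun B hB ε hε => by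
    filter_upwards [(Metric.tendsto_nhds.1 (h B hB)) ε hε] with n hn
    simpa using hn.le
  refine Metric.tendsto_nhds.2 fun δ hδ => ?_
  obtain ⟨ε, hε, hεδ⟩ : ∃ ε > 0, 4 * ε < δ := ⟨δ / 8, by positivity, by linarith⟩
  let C : ℕ → Set (ℕ → Bool) := fun m =>
    ⋂ n ≥ m, {x | |natMeas (ν n) {i ∈ A | x i = true}| ≤ ε}
  have hclosed : ∀ m, IsClosed (C m) := fun m => isClosed_biInter fun n _ =>
    isClosed_le (continuous_natMeas (ν n) A).abs continuous_const
  have hcover : ⋃ m, C m = univ := eq_univ_of_forall fun x => by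
    obtain ⟨m, hm⟩ := eventually_atTop.1 (habs {i ∈ A | x i = true} (sep_subset _ _) ε hε)
    exact mem_iUnion.2 ⟨m, mem_iInter₂.2 hm⟩
  obtain ⟨m, x, hx⟩ := nonempty_interior_of_iUnion_of_closed hclosed hcover
  obtain ⟨I, u, hu, hI⟩ := isOpen_pi_iff.1 isOpen_interior x hx
  have hsmall : Tendsto (fun n => ∑ i ∈ I, A.indicator (fun j => |ν n j|) i) atTop (𝓝 0) := by
    rw [← Finset.sum_const_zero (s := I)]
    refine tendsto_finsetSum _ fun i _ => ?_
    by_cases hA : i ∈ A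
    · simpa [hA, natMeas_singleton] using (h {i} (by simpa using hA)).abs
    · simp [hA]
  filter_upwards [hsmall.eventually_le_const hε, eventually_ge_atTop m] with n hn hmn
  have key : ∀ B ⊆ A, |natMeas (ν n) B| ≤ 2 * ε := fun B hB => by
    classical
    let y : ℕ → Bool := fun i => if i ∈ I then x i else decide (i ∈ B)
    have hy : y ∈ C m := interior_subset (hI fun i hi => by
      simpa [y, Finset.mem_coe.1 hi] using (hu i hi).2)
    have h1 : |natMeas (ν n) {i ∈ A | y i = true}| ≤ ε := mem_iInter₂.1 hy n hmn
    have h2 := abs_natMeas_sub_le (ν n) hB (sep_subset A fun i => y i = true) I fun i hi => by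
      simpa [y, hi] using fun hi => hB hi
    have h3 := abs_sub_abs_le_abs_sub (natMeas (ν n) B) (natMeas (ν n) {i ∈ A | y i = true})
    linarith
  have hpos := abs_le.1 (key {i ∈ A | 0 < ν n i} (sep_subset _ _))
  have hneg := abs_le.1 (key {i ∈ A | ν n i ≤ 0} (sep_subset _ _))
  rw [Real.dist_0_eq_abs, abs_of_nonneg (natVar_nonneg _ _), natVar_eq_natMeas_sub]
  linarith [hpos.2, hneg.1]

lemma fsMeas_image_some (μ : Option ℕ →₀ ℝ) (A : Set ℕ) :
    fsMeas μ (some '' A) = natMeas μ.some A := by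
  classical
  have := μ.sum_option_index (fun x a => (some '' A).indicator (fun _ => a) x)
    (by simp) (fun o a b => by by_cases h : o ∈ some '' A <;> simp [h])
  simpa [Finsupp.sum, fsMeas, natMeas, indicator] using this

lemma fsMeas_univ (μ : Option ℕ →₀ ℝ) : fsMeas μ univ = μ none + natMeas μ.some univ := by
  have := μ.sum_option_index (fun _ a => a) (by simp) (by simp)
  simpa [Finsupp.sum, fsMeas, natMeas] using this

lemma fsNorm_le (μ : Option ℕ →₀ ℝ) : fsNorm μ ≤ |fsMeas μ univ| + 2 * natVar μ.some univ := by
  classical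
  have h1 : fsNorm μ = |μ none| + natVar μ.some univ := by
    unfold fsNorm natVar
    rw [Finset.sum_subset (s₂ := insert none (μ.some.support.map Function.Embedding.some))]
    · simp
    · intro x hx
      cases x <;> simp_all
    · simp +contextual
  have h2 : |natMeas μ.some univ| ≤ natVar μ.some univ := by
    simpa [natMeas, natVar] using Finset.abs_sum_le_sum_abs _ _
  have h3 : |μ none| ≤ |fsMeas μ univ| + |natMeas μ.some univ| := by
    rw [fsMeas_univ]
    simpa using abs_sub (μ none + natMeas μ.some univ) (natMeas μ.some univ)
  linarith

lemma isClopen_image_some {F : Filter ℕ} {A : Set ℕ} (hA : Aᶜ ∈ F) :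
    @IsClopen _ (NFTop F) (some '' A) := by
  let := NFTop F
  refine ⟨⟨fun _ => ?_⟩, fun h => ?_⟩
  · simpa [← compl_def] using hA
  · simp at h

/-- Any finite set `T` can be mapped to `ℕ` so that its counting measure is pushed forward below
`T.card * |ν|`, up to an error of one point for each atom of `ν`. -/
lemma exists_sampling (ν : ℕ →₀ ℝ) (hν : 1 ≤ natVar ν univ) (T : Finset ℕ) :
    ∃ g : ℕ → ℕ, ∀ A : Set ℕ,
      ({j ∈ (T : Set ℕ) | g j ∈ A}.ncard : ℝ) ≤ T.card * natVar ν A + ν.support.card := by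
  classical
  let c : ℕ → ℕ := fun i => ⌈T.card * |ν i|⌉₊
  let S : Finset (Σ _ : ℕ, ℕ) := ν.support.sigma fun i => Finset.range (c i)
  have hcard : T.card ≤ S.card := by
    rw [Finset.card_sigma]
    have : (T.card : ℝ) ≤ ∑ i ∈ ν.support, (c i : ℝ) := by
      calc (T.card : ℝ) ≤ T.card * natVar ν univ := le_mul_of_one_le_right (by positivity) hν
        _ ≤ _ := by
          simp only [natVar, indicator_univ, Finset.mul_sum]
          exact Finset.sum_le_sum fun i _ => Nat.le_ceil _
    simpa using mod_cast this
  obtain ⟨e⟩ : Nonempty (T ↪ S) := Function.Embedding.nonempty_of_card_le (by simpa using hcard)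
  refine ⟨fun j => if hj : j ∈ T then (e ⟨j, hj⟩).1.1 else 0, fun A => ?_⟩
  have hle : {j ∈ (T : Set ℕ) | (if hj : j ∈ T then (e ⟨j, hj⟩).1.1 else 0) ∈ A}.ncard ≤
      (S.filter fun p => p.1 ∈ A).card := by
    rw [← Set.ncard_coe_finset]
    refine Set.ncard_le_ncard_of_injOn
      (fun j => if hj : j ∈ T then (e ⟨j, hj⟩).1 else ⟨0, 0⟩) ?_ ?_ (Finset.finite_toSet _)
    · rintro j ⟨hj, hA⟩
      have hj' : j ∈ T := hj
      simp only [hj', dif_pos] at hA ⊢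
      exact Finset.mem_coe.2 (Finset.mem_filter.2 ⟨(e ⟨j, hj⟩).2, hA⟩)
    · rintro j ⟨hj, -⟩ k ⟨hk, -⟩ hjk
      have hj' : j ∈ T := hj
      have hk' : k ∈ T := hk
      simp only [hj', hk', dif_pos] at hjk
      simpa using e.injective (Subtype.ext hjk)
  have hS : (S.filter fun p => p.1 ∈ A).card = ∑ i ∈ ν.support, if i ∈ A then c i else 0 := by
    rw [Finset.card_filter, Finset.sum_sigma]
    refine Finset.sum_congr rfl fun i _ => ?_
    by_cases hA : i ∈ A <;> simp [hA]
  refine (Nat.cast_le.2 hle).trans ?_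
  rw [hS, natVar, Finset.mul_sum, Finset.card_eq_sum_ones ν.support]
  simp only [Nat.cast_sum, Nat.cast_ite, Nat.cast_zero, Nat.cast_one]
  rw [← Finset.sum_add_distrib]
  refine Finset.sum_le_sum fun i _ => ?_
  by_cases hA : i ∈ A
  · simpa [hA, c] using (Nat.ceil_lt_add_one (by positivity)).le
  · simp [hA]

lemma mem_Zideal_of_tendsto {A : Set ℕ}
    (h : Tendsto (fun n : ℕ => ((A ∩ Ico (2 ^ n) (2 ^ (n + 1))).ncard : ℝ) / 2 ^ n) atTop (𝓝 0)) :
    A ∈ Zideal := by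
  have h' : Tendsto (fun n : ℕ => ((A ∩ Ico (2 ^ n) (2 ^ (n + 1))).ncard : ℝ≥0∞) / 2 ^ n)
      atTop (𝓝 0) := by
    have := ENNReal.tendsto_ofReal h
    rw [ENNReal.ofReal_zero] at this
    refine this.congr fun n => ?_
    rw [ENNReal.ofReal_div_of_pos (by positivity), ENNReal.ofReal_natCast,
      ENNReal.ofReal_pow (by norm_num)]
    norm_num
  refine ENNReal.tendsto_nhds_zero.2 fun ε hε => ?_
  obtain ⟨N, hN⟩ := eventually_atTop.1 (ENNReal.tendsto_nhds_zero.1 h' ε hε)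
  filter_upwards [eventually_ge_atTop (2 ^ N)] with m hm
  refine iSup_le fun n => ?_
  rcases lt_or_ge n N with hn | hn
  · have : (A \ Iic m) ∩ Ico (2 ^ n) (2 ^ (n + 1)) = ∅ := by
      refine eq_empty_of_forall_notMem fun j hj => hj.1.2 ?_
      exact hj.2.2.le.trans ((Nat.pow_le_pow_right two_pos hn).trans hm)
    simp [this]
  · refine le_trans ?_ (hN n hn)
    gcongr
    · exact (finite_Ico _ _).inter_of_right _
    · exact sdiff_subset

/-- There is a sequence of indices tending to infinity so slowly that `s` along it is negligible
compared with `2 ^ n`. -/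
lemma exists_slow_index (s : ℕ → ℕ) :
    ∃ k : ℕ → ℕ, Tendsto k atTop atTop ∧ ∀ n, k n * s (k n) ≤ 2 ^ n := by
  classical
  refine ⟨fun n => Nat.findGreatest (fun k => k * s k ≤ 2 ^ n) n, ?_, fun n => ?_⟩
  · refine tendsto_atTop.2 fun K => ?_
    filter_upwards [eventually_ge_atTop K, eventually_ge_atTop (K * s K)] with n h1 h2
    exact Nat.le_findGreatest h1 (h2.trans Nat.lt_two_pow_self.le)
  · exact Nat.findGreatest_spec (P := fun k => k * s k ≤ 2 ^ n) (Nat.zero_le n) (by simp)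

/-- A family on which a sequence of finitely supported measures with total variation at least `1`
converges to `0` in variation is Katětov below the density zero ideal. -/
lemma katLE_Zideal {I : Set (Set ℕ)} {ν : ℕ → ℕ →₀ ℝ} (hν : ∀ n, 1 ≤ natVar (ν n) univ)
    (hI : ∀ A ∈ I, Tendsto (fun n => natVar (ν n) A) atTop (𝓝 0)) : KatLE I Zideal := by
  obtain ⟨k, hk, hks⟩ := exists_slow_index fun n => (ν n).support.card
  choose g hg using fun n =>
    exists_sampling (ν (k n)) (hν (k n)) (Finset.Ico (2 ^ n) (2 ^ (n + 1)))
  refine ⟨fun j => g (Nat.log 2 j) j, fun A hA => mem_Zideal_of_tendsto ?_⟩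
  have hlim : Tendsto (fun n => natVar (ν (k n)) A + 1 / (k n : ℝ)) atTop (𝓝 0) := by
    simpa using ((hI A hA).comp hk).add
      ((tendsto_one_div_atTop_nhds_zero_nat (𝕜 := ℝ)).comp hk)
  refine squeeze_zero' (Eventually.of_forall fun n => by positivity) ?_ hlim
  filter_upwards [hk.eventually_gt_atTop 0] with n hn
  have hset : (fun j => g (Nat.log 2 j) j) ⁻¹' A ∩ Ico (2 ^ n) (2 ^ (n + 1)) =
      {j ∈ (Finset.Ico (2 ^ n) (2 ^ (n + 1)) : Set ℕ) | g n j ∈ A} := by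
    ext j
    simp only [mem_inter_iff, mem_preimage, Finset.coe_Ico, mem_ofPred_eq,
      and_comm (b := j ∈ Ico _ _)]
    refine and_congr_right fun hj => ?_
    rw [Nat.log_eq_of_pow_le_of_lt_pow hj.1 hj.2]
  have hc : ((Finset.Ico (2 ^ n) (2 ^ (n + 1))).card : ℝ) = 2 ^ n := by
    rw [Nat.card_Ico, pow_succ, mul_two, Nat.add_sub_cancel]
    simp
  have h1 := hg n A
  rw [hc] at h1
  have hk0 : (0 : ℝ) < k n := mod_cast hn
  have h2 : (k n : ℝ) * (ν (k n)).support.card ≤ 2 ^ n := mod_cast hks n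
  have h3 : ((ν (k n)).support.card : ℝ) ≤ 2 ^ n * (1 / k n) := by
    rw [mul_one_div, le_div_iff₀ hk0]
    linarith
  rw [hset, div_le_iff₀ (by positivity)]
  linarith

/-- Corollary `zz`. If a free filter `F` on `ω` does not have the Nikodym
property, then its dual ideal `F*` is Katětov below the asymptotic density zero ideal `Z`. -/
theorem dual_ideal_katetov_below_Z (F : Filter ℕ)
    (hfree : F ≤ Filter.cofinite) (hne : F.NeBot)
    (h : ¬ HasNikodymProp F) :
    KatLE {A : Set ℕ | Aᶜ ∈ F} Zideal := by
  obtain ⟨μ, hnorm, hμ⟩ := not_not.1 h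
  have hvar : ∀ᶠ n in atTop, 1 ≤ natVar (μ n).some univ := by
    have huniv := (hμ univ (@isClopen_univ _ (NFTop F))).abs.eventually_le_const
      (show |(0 : ℝ)| < 1 by simp)
    filter_upwards [huniv, hnorm.eventually_ge_atTop 3] with n h1 h2
    linarith [fsNorm_le (μ n)]
  obtain ⟨N, hN⟩ := eventually_atTop.1 hvar
  refine katLE_Zideal (ν := fun n => (μ (n + N)).some) (fun n => hN _ (Nat.le_add_left _ _))
    fun A hA => ?_
  refine (tendsto_add_atTop_iff_nat (f := fun n => natVar (μ n).some A) N).2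
    (tendsto_natVar_zero fun B hB => ?_)
  simpa only [fsMeas_image_some] using
    hμ _ (isClopen_image_some (mem_of_superset hA (compl_subset_compl.2 hB)))
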